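/- Let A, B, X be jointly distributed discrete random variables taking finitely many values in a commutative group. Then H(A − B) + H(X, A, B) ≤ H(A + X, B + X) + H(A, B). If A, B, X are independent, then H(A − B) + H(X) ≤ H(A + X) + H(B + X). If A, B, X are i.i.d., then H(A − B) + H(A) ≤ 2 H(A + B). -/

import Mathlib

/-- The probability of the event `E` under the probability mass function `p`
on a finite sample space. -/
noncomputable def prob {Ω : Type*} [Fintype Ω] (p : Ω → ℝ) (E : Set Ω) : ℝ :=
  ∑ ω, E.indicator p ω

/-- The Shannon entropy (base 2) of the discrete random variable `X` on the finite
probability space given by the probability mass function `p`. -/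
noncomputable def ent {Ω S : Type*} [Fintype Ω] (p : Ω → ℝ) (X : Ω → S) : ℝ :=
  letI := Classical.decEq S
  ∑ v ∈ Finset.univ.image X,
      -(prob p {ω | X ω = v} * Real.logb 2 (prob p {ω | X ω = v}))

open Classical in
lemma prob_eq {Ω : Type*} [Fintype Ω] (p : Ω → ℝ) (P : Ω → Prop) :
    prob p {ω | P ω} = ∑ ω, if P ω then p ω else 0 := by
  unfold prob
  refine Finset.sum_congr rfl fun ω _ => ?_
  simp [Set.indicator_apply]

lemma prob_nonneg' {Ω : Type*} [Fintype Ω] (p : Ω → ℝ) (hp : ∀ ω, 0 ≤ p ω) (E : Set Ω) :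
    0 ≤ prob p E :=
  Finset.sum_nonneg fun ω _ => Set.indicator_nonneg (fun x _ => hp x) ω

lemma le_prob {Ω : Type*} [Fintype Ω] (p : Ω → ℝ) (hp : ∀ ω, 0 ≤ p ω) (E : Set Ω) (ω : Ω)
    (h : ω ∈ E) : p ω ≤ prob p E := by
  have := Finset.single_le_sum (f := fun ω => E.indicator p ω)
    (fun ω _ => Set.indicator_nonneg (fun x _ => hp x) ω) (Finset.mem_univ ω)
  simpa [prob, h] using this

lemma ent_eq {Ω S : Type*} [Fintype Ω] (p : Ω → ℝ) (X : Ω → S) :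
    ent p X = - ∑ ω, p ω * Real.logb 2 (prob p {ω' | X ω' = X ω}) := by
  classical
  unfold ent
  rw [Finset.sum_neg_distrib]
  congr 1
  have h : ∀ v, prob p {ω | X ω = v} * Real.logb 2 (prob p {ω | X ω = v}) =
      ∑ ω, if X ω = v then p ω * Real.logb 2 (prob p {ω' | X ω' = X ω}) else 0 := by
    intro v
    generalize hL : Real.logb 2 (prob p {ω | X ω = v}) = L
    rw [prob_eq, Finset.sum_mul]
    refine Finset.sum_congr rfl fun ω _ => ?_
    by_cases h : X ω = v
    · subst h; simp [hL]
    · simp [h]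
  simp_rw [h]
  rw [Finset.sum_comm]
  refine Finset.sum_congr rfl fun ω _ => ?_
  rw [Finset.sum_ite_eq]
  simp

lemma ent_key {Ω S T R Q : Type*} [Fintype Ω] (p : Ω → ℝ)
    (hp : ∀ ω, 0 ≤ p ω) (hp1 : ∑ ω, p ω = 1) (Z : Ω → S) (W : Ω → T) (U : Ω → R) (V : Ω → Q)
    (hU : ∀ ω ω', U ω = U ω' → Z ω = Z ω') (hV : ∀ ω ω', V ω = V ω' → Z ω = Z ω')
    (hW : ∀ ω ω', U ω = U ω' → V ω = V ω' → W ω = W ω') :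
    ent p Z + ent p W ≤ ent p U + ent p V := by
  classical
  simp only [ent_eq]
  set z := fun ω => prob p {ω' | Z ω' = Z ω} with hz
  set w := fun ω => prob p {ω' | W ω' = W ω} with hw
  set u := fun ω => prob p {ω' | U ω' = U ω} with hu
  set v := fun ω => prob p {ω' | V ω' = V ω} with hv
  have z0 : ∀ ω, 0 ≤ z ω := fun ω => prob_nonneg' p hp _
  have w0 : ∀ ω, 0 ≤ w ω := fun ω => prob_nonneg' p hp _
  have main : ∑ ω, p ω * (u ω * v ω / (z ω * w ω)) ≤ 1 := by
    have e : ∑ ω, p ω * (u ω * v ω / (z ω * w ω)) = ∑ a, ∑ b, p a * p b *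
        ∑ ω, (if U a = U ω ∧ V b = V ω then p ω / (z ω * w ω) else 0) := by
      simp_rw [Finset.mul_sum]
      rw [Finset.sum_congr rfl (fun a _ => Finset.sum_comm), Finset.sum_comm]
      refine Finset.sum_congr rfl fun ω _ => ?_
      have : p ω * (u ω * v ω / (z ω * w ω)) = u ω * v ω * (p ω / (z ω * w ω)) := by ring
      rw [this]
      simp only [hu, hv, prob_eq]
      rw [Finset.sum_mul_sum, Finset.sum_mul]
      refine Finset.sum_congr rfl fun a _ => ?_
      rw [Finset.sum_mul]
      refine Finset.sum_congr rfl fun b _ => ?_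
      by_cases h1 : U a = U ω <;> by_cases h2 : V b = V ω <;> simp [h1, h2]
    rw [e, ← hp1]
    refine Finset.sum_le_sum fun a _ => ?_
    have inner : ∀ b, ∑ ω, (if U a = U ω ∧ V b = V ω then p ω / (z ω * w ω) else 0) ≤
        if Z b = Z a then 1 / z a else 0 := by
      intro b
      by_cases hex : ∃ c, U a = U c ∧ V b = V c
      · obtain ⟨c, hc1, hc2⟩ := hex
        have hza : Z a = Z c := hU _ _ hc1
        have hzb : Z b = Z a := (hV _ _ hc2).trans hza.symm
        rw [if_pos hzb]
        have : ∀ ω, (if U a = U ω ∧ V b = V ω then p ω / (z ω * w ω) else 0) =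
            (if U a = U ω ∧ V b = V ω then p ω else 0) * (1 / (z a * w c)) := by
          intro ω
          split_ifs with h
          · have h1 : Z ω = Z a := (hU _ _ h.1).symm
            have h2 : W ω = W c := hW _ _ (h.1.symm.trans hc1) (h.2.symm.trans hc2)
            simp only [hz, hw, h1, h2]; ring
          · simp
        simp_rw [this]
        rw [← Finset.sum_mul]
        have hle : ∑ ω, (if U a = U ω ∧ V b = V ω then p ω else 0) ≤ w c := by
          simp only [hw, prob_eq]
          refine Finset.sum_le_sum fun ω _ => ?_
          split_ifs with h h' h'
          · exact le_rfl
          · exact absurd (hW _ _ (h.1.symm.trans hc1) (h.2.symm.trans hc2)) h'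
          · exact hp ω
          · exact le_rfl
        have hn : 0 ≤ 1 / (z a * w c) := by have := z0 a; have := w0 c; positivity
        refine (mul_le_mul_of_nonneg_right hle hn).trans ?_
        by_cases hwc : w c = 0
        · rw [hwc]; have := z0 a; simpa using this
        · apply le_of_eq
          by_cases hza : z a = 0
          · simp [hza]
          · field_simp
      · rw [Finset.sum_eq_zero]
        · have := z0 a
          split_ifs <;> positivity
        · intro ω _
          rw [if_neg fun h => hex ⟨ω, h⟩]
    calc _ ≤ ∑ b, p a * p b * (if Z b = Z a then 1 / z a else 0) :=
          Finset.sum_le_sum fun b _ =>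
            mul_le_mul_of_nonneg_left (inner b) (mul_nonneg (hp a) (hp b))
      _ = p a * (z a * (1 / z a)) := by
          conv_rhs => rw [hz]; simp only [prob_eq]
          rw [Finset.sum_mul, Finset.mul_sum]
          refine Finset.sum_congr rfl fun b _ => ?_
          split_ifs
          · simp only [hz, prob_eq]; ring
          · simp
      _ ≤ p a := by
          by_cases hza : z a = 0
          · simp [hza, hp a]
          · field_simp; exact le_rfl
  have pt : ∀ ω, p ω * Real.logb 2 (u ω) + p ω * Real.logb 2 (v ω) - p ω * Real.logb 2 (z ω)
      - p ω * Real.logb 2 (w ω) ≤ (p ω * (u ω * v ω / (z ω * w ω)) - p ω) / Real.log 2 := by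
    intro ω
    rcases (hp ω).eq_or_lt with h | h
    · simp [← h]
    have hu' : 0 < u ω := h.trans_le (le_prob p hp _ _ rfl)
    have hv' : 0 < v ω := h.trans_le (le_prob p hp _ _ rfl)
    have hz' : 0 < z ω := h.trans_le (le_prob p hp _ _ rfl)
    have hw' : 0 < w ω := h.trans_le (le_prob p hp _ _ rfl)
    have hl := Real.log_le_sub_one_of_pos (x := u ω * v ω / (z ω * w ω)) (by positivity)
    rw [Real.log_div (by positivity) (by positivity), Real.log_mul hu'.ne' hv'.ne',
      Real.log_mul hz'.ne' hw'.ne'] at hl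
    have h2 : 0 < Real.log 2 := Real.log_pos (by norm_num)
    unfold Real.logb
    rw [le_div_iff₀ h2]
    have := mul_le_mul_of_nonneg_left hl h.le
    field_simp
    field_simp at this
    linarith
  have s := Finset.sum_le_sum (s := Finset.univ) fun ω _ => pt ω
  rw [← Finset.sum_div, Finset.sum_sub_distrib, Finset.sum_sub_distrib, Finset.sum_sub_distrib,
    Finset.sum_add_distrib, hp1] at s
  have h2 : 0 < Real.log 2 := Real.log_pos (by norm_num)
  have := div_nonpos_of_nonpos_of_nonneg (sub_nonpos.2 main) h2.le
  linarith

lemma ent_pair_le {Ω R Q : Type*} [Fintype Ω] (p : Ω → ℝ)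
    (hp : ∀ ω, 0 ≤ p ω) (hp1 : ∑ ω, p ω = 1) (U : Ω → R) (V : Ω → Q) :
    ent p (fun ω => (U ω, V ω)) ≤ ent p U + ent p V := by
  have h := ent_key p hp hp1 (fun _ => ()) (fun ω => (U ω, V ω)) U V
    (fun _ _ _ => rfl) (fun _ _ _ => rfl) (fun _ _ h1 h2 => by simp [h1, h2])
  have h0 : ent p (fun _ : Ω => ()) = 0 := by
    simp [ent_eq, prob, hp1]
  linarith

lemma ent_triple {Ω G : Type*} [Fintype Ω] (p : Ω → ℝ)
    (hp : ∀ ω, 0 ≤ p ω) (A B X : Ω → G)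
    (h : ∀ a b x : G, prob p {ω | A ω = a ∧ B ω = b ∧ X ω = x} =
        prob p {ω | A ω = a} * prob p {ω | B ω = b} * prob p {ω | X ω = x}) :
    ent p (fun ω => (X ω, A ω, B ω)) = ent p X + ent p A + ent p B := by
  simp only [ent_eq]
  rw [← neg_add, ← neg_add, ← Finset.sum_add_distrib, ← Finset.sum_add_distrib]
  congr 1
  refine Finset.sum_congr rfl fun ω _ => ?_
  rcases (hp ω).eq_or_lt with h0 | h0
  · simp [← h0]
  have e : {ω' | (X ω', A ω', B ω') = (X ω, A ω, B ω)} =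
      {ω' | A ω' = A ω ∧ B ω' = B ω ∧ X ω' = X ω} := by
    ext; simp; tauto
  have hA : 0 < prob p {ω' | A ω' = A ω} := h0.trans_le (le_prob p hp _ _ rfl)
  have hB : 0 < prob p {ω' | B ω' = B ω} := h0.trans_le (le_prob p hp _ _ rfl)
  have hX : 0 < prob p {ω' | X ω' = X ω} := h0.trans_le (le_prob p hp _ _ rfl)
  rw [e, h, Real.logb_mul (by positivity) hX.ne', Real.logb_mul hA.ne' hB.ne']
  ring

lemma ent_congr {Ω S : Type*} [Fintype Ω] (p : Ω → ℝ) (X Y : Ω → S)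
    (h : ∀ g, prob p {ω | X ω = g} = prob p {ω | Y ω = g}) : ent p X = ent p Y := by
  classical
  have key : ∀ (T : Finset S) (Z : Ω → S), Finset.univ.image Z ⊆ T → ent p Z =
      ∑ v ∈ T, -(prob p {ω | Z ω = v} * Real.logb 2 (prob p {ω | Z ω = v})) := by
    intro T Z hT
    have : ent p Z = ∑ v ∈ Finset.univ.image Z,
        -(prob p {ω | Z ω = v} * Real.logb 2 (prob p {ω | Z ω = v})) := by
      unfold ent
      congr!
    rw [this]
    refine Finset.sum_subset hT fun v _ hv => ?_
    have hn : ∀ ω, Z ω ≠ v := fun ω hω => hv (by simp [← hω])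
    simp [prob, hn]
  rw [key (Finset.univ.image X ∪ Finset.univ.image Y) X Finset.subset_union_left,
    key (Finset.univ.image X ∪ Finset.univ.image Y) Y Finset.subset_union_right]
  simp_rw [h]

open Classical in
lemma prob_triple {Ω G : Type*} [Fintype Ω] (p : Ω → ℝ) (A B X : Ω → G) (T : Finset G)
    (hA : ∀ ω, A ω ∈ T) (hB : ∀ ω, B ω ∈ T) (hX : ∀ ω, X ω ∈ T) (P : G → G → G → Prop) :
    prob p {ω | P (A ω) (B ω) (X ω)} = ∑ a ∈ T, ∑ b ∈ T, ∑ x ∈ T,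
      if P a b x then prob p {ω | A ω = a ∧ B ω = b ∧ X ω = x} else 0 := by
  have e : ∀ a b x, (if P a b x then prob p {ω | A ω = a ∧ B ω = b ∧ X ω = x} else 0) =
      ∑ ω, if A ω = a then (if B ω = b then (if X ω = x then
        (if P (A ω) (B ω) (X ω) then p ω else 0) else 0) else 0) else 0 := by
    intro a b x
    rw [prob_eq]
    by_cases h : P a b x
    · rw [if_pos h]
      refine Finset.sum_congr rfl fun ω _ => ?_
      by_cases h1 : A ω = a
      · by_cases h2 : B ω = b
        · by_cases h3 : X ω = x
          · simp [h1, h2, h3, h]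
          · simp [h3]
        · simp [h2]
      · simp [h1]
    · rw [if_neg h, Finset.sum_eq_zero]
      intro ω _
      by_cases h1 : A ω = a
      · by_cases h2 : B ω = b
        · by_cases h3 : X ω = x
          · simp [h1, h2, h3, h]
          · simp [h3]
        · simp [h2]
      · simp [h1]
  simp_rw [e]
  rw [Finset.sum_congr rfl fun a _ => Finset.sum_congr rfl fun b _ => Finset.sum_comm]
  rw [Finset.sum_congr rfl fun a _ => Finset.sum_comm, Finset.sum_comm, prob_eq]
  refine Finset.sum_congr rfl fun ω _ => ?_
  rw [Finset.sum_eq_single (A ω), Finset.sum_eq_single (B ω), Finset.sum_eq_single (X ω)]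
  · simp
  · intro x _ hx; simp [hx.symm]
  · intro h; exact absurd (hX ω) h
  · intro x _ hx; simp [hx.symm]
  · intro h; exact absurd (hB ω) h
  · intro x _ hx; simp [hx.symm]
  · intro h; exact absurd (hA ω) h

theorem entropy_triangle_inequality {Ω G : Type*} [Fintype Ω] [AddCommGroup G] (p : Ω → ℝ)
    (hp : ∀ ω, 0 ≤ p ω) (hp1 : ∑ ω, p ω = 1) (A B X : Ω → G) :
    (ent p (fun ω => A ω - B ω) + ent p (fun ω => (X ω, A ω, B ω)) ≤
      ent p (fun ω => (A ω + X ω, B ω + X ω)) + ent p (fun ω => (A ω, B ω))) ∧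
    ((∀ a b x : G, prob p {ω | A ω = a ∧ B ω = b ∧ X ω = x} =
        prob p {ω | A ω = a} * prob p {ω | B ω = b} * prob p {ω | X ω = x}) →
      ent p (fun ω => A ω - B ω) + ent p X ≤
        ent p (fun ω => A ω + X ω) + ent p (fun ω => B ω + X ω)) ∧
    ((∀ a b x : G, prob p {ω | A ω = a ∧ B ω = b ∧ X ω = x} =
        prob p {ω | A ω = a} * prob p {ω | B ω = b} * prob p {ω | X ω = x}) →
      (∀ g : G, prob p {ω | B ω = g} = prob p {ω | A ω = g}) →
      (∀ g : G, prob p {ω | X ω = g} = prob p {ω | A ω = g}) →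
      ent p (fun ω => A ω - B ω) + ent p A ≤ 2 * ent p (fun ω => A ω + B ω)) := by
  have h1 : ent p (fun ω => A ω - B ω) + ent p (fun ω => (X ω, A ω, B ω)) ≤
      ent p (fun ω => (A ω + X ω, B ω + X ω)) + ent p (fun ω => (A ω, B ω)) := by
    refine ent_key p hp hp1 _ _ _ _ ?_ ?_ ?_
    · intro ω ω' h
      simp only [Prod.mk.injEq] at h
      rw [← add_sub_add_right_eq_sub (A ω) (B ω) (X ω), h.1, h.2, add_sub_add_right_eq_sub]
    · intro ω ω' h
      simp only [Prod.mk.injEq] at h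
      rw [h.1, h.2]
    · intro ω ω' h h'
      simp only [Prod.mk.injEq] at h h' ⊢
      refine ⟨?_, h'⟩
      have := h.1
      rw [h'.1] at this
      exact add_left_cancel this
  have h2 : (∀ a b x : G, prob p {ω | A ω = a ∧ B ω = b ∧ X ω = x} =
        prob p {ω | A ω = a} * prob p {ω | B ω = b} * prob p {ω | X ω = x}) →
      ent p (fun ω => A ω - B ω) + ent p X ≤
        ent p (fun ω => A ω + X ω) + ent p (fun ω => B ω + X ω) := by
    intro hi
    have e := ent_triple p hp A B X hi
    have s1 := ent_pair_le p hp hp1 A B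
    have s2 := ent_pair_le p hp hp1 (fun ω => A ω + X ω) (fun ω => B ω + X ω)
    linarith
  refine ⟨h1, h2, ?_⟩
  intro hi hB hX
  have h := h2 hi
  classical
  set T : Finset G := Finset.univ.image A ∪ Finset.univ.image B ∪ Finset.univ.image X with hT
  have mA : ∀ ω, A ω ∈ T := fun ω => by simp [hT]
  have mB : ∀ ω, B ω ∈ T := fun ω => by simp [hT]
  have mX : ∀ ω, X ω ∈ T := fun ω => by simp [hT]
  have e0 : ent p X = ent p A := ent_congr p _ _ hX
  have e1 : ent p (fun ω => A ω + X ω) = ent p (fun ω => A ω + B ω) := by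
    refine ent_congr p _ _ fun g => ?_
    rw [prob_triple p A B X T mA mB mX (fun a _ x => a + x = g),
      prob_triple p A B X T mA mB mX (fun a b _ => a + b = g)]
    simp_rw [hi, hB, hX]
    refine Finset.sum_congr rfl fun a _ => ?_
    rw [Finset.sum_comm]
    refine Finset.sum_congr rfl fun b _ => Finset.sum_congr rfl fun x _ => ?_
    rw [mul_right_comm]
  have e2 : ent p (fun ω => B ω + X ω) = ent p (fun ω => A ω + X ω) := by
    refine ent_congr p _ _ fun g => ?_
    rw [prob_triple p A B X T mA mB mX (fun _ b x => b + x = g),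
      prob_triple p A B X T mA mB mX (fun a _ x => a + x = g)]
    simp_rw [hi, hB, hX]
    rw [Finset.sum_comm]
    refine Finset.sum_congr rfl fun a _ => Finset.sum_congr rfl fun b _ =>
      Finset.sum_congr rfl fun x _ => ?_
    rw [mul_comm (prob p {ω | A ω = a})]
  linarith
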